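/- For all positive integers n and integers k ≥ 2, the n×n determinant over ℚ with (i,j)-entry (2k+1)/(i+j+k+3)·C(2i+2j+4, i+j+k+2), for 0 ≤ i, j ≤ n−1, equals: (−1)^{kn₁+C(k,2)+1} if n = n₁(2k+1)−k−2 for a positive integer n₁; (−1)^{kn₁+C(k+1,2)}·(n+k+1) if n = n₁(2k+1)−k−1; (−1)^{k(n₁+1)}·(n+1) if n = n₁(2k+1)−1; (−1)^{kn₁} if n = n₁(2k+1); and 0 if n is congruent to none of 0, k−1, k, 2k modulo 2k+1. For k = 0, the determinant det_{0≤i,j≤n−1}( (1/(i+j+3))·C(2i+2j+4, i+j+2) ) equals n+1. -/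

import Mathlib

section

open Polynomial

/-- The monic polynomials orthonormal for the functional with moments `catalan (m + 1)`:
`S_n(X - 2)` with `S_n` the rescaled Chebyshev polynomials of the second kind. -/
noncomputable def shiftedS : ℕ → ℚ[X]
  | 0 => 1
  | 1 => X - 2
  | n + 2 => (X - 2) * shiftedS (n + 1) - shiftedS n

/-- The polynomial equal to `∑_{|t| ≤ k} w ^ t` at `X = 2 + w + w⁻¹`. -/
noncomputable def dirichletPoly : ℕ → ℚ[X]
  | 0 => 1
  | 1 => X - 1
  | n + 2 => (X - 2) * dirichletPoly (n + 1) - dirichletPoly n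

lemma monic_natDegree_of_rec {p : ℕ → ℚ[X]} (h0 : p 0 = 1)
    (h1 : (p 1).Monic ∧ (p 1).natDegree = 1)
    (hp : ∀ n, p (n + 2) = (X - 2) * p (n + 1) - p n) (n : ℕ) :
    (p n).Monic ∧ (p n).natDegree = n := by
  have hX : (X - 2 : ℚ[X]).Monic := monic_X_sub_C 2
  have hX' : (X - 2 : ℚ[X]).natDegree = 1 := natDegree_X_sub_C 2
  induction n using Nat.twoStepInduction with
  | zero => simp [h0]
  | one => exact h1
  | more n ih ih' =>
    have hm := hX.mul ih'.1
    have hd : ((X - 2) * p (n + 1)).natDegree = n + 2 := by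
      rw [hX.natDegree_mul ih'.1, hX', ih'.2]; ring
    have hlt : (p n).degree < ((X - 2) * p (n + 1)).degree := by
      apply degree_lt_degree; rw [hd, ih.2]; lia
    rw [hp]
    exact ⟨hm.sub_of_left hlt, by rw [natDegree_sub_eq_left_of_natDegree_lt (by lia), hd]⟩

lemma shiftedS_monic_natDegree (n : ℕ) : (shiftedS n).Monic ∧ (shiftedS n).natDegree = n :=
  monic_natDegree_of_rec rfl ⟨monic_X_sub_C 2, natDegree_X_sub_C 2⟩ (fun _ => rfl) n

lemma dirichletPoly_monic_natDegree (n : ℕ) :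
    (dirichletPoly n).Monic ∧ (dirichletPoly n).natDegree = n :=
  monic_natDegree_of_rec rfl ⟨monic_X_sub_C 1, natDegree_X_sub_C 1⟩ (fun _ => rfl) n

lemma shiftedS_eval_zero (n : ℕ) : (shiftedS n).eval 0 = (-1) ^ n * (n + 1) := by
  induction n using Nat.twoStepInduction with
  | zero => simp [shiftedS]
  | one => norm_num [shiftedS]
  | more n ih ih' => simp [shiftedS, ih, ih', pow_succ]; ring

lemma dirichletPoly_eval_zero (n : ℕ) : (dirichletPoly n).eval 0 = (-1) ^ n := by
  induction n using Nat.twoStepInduction with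
  | zero => simp [dirichletPoly]
  | one => norm_num [dirichletPoly]
  | more n ih ih' => simp [dirichletPoly, ih, ih', pow_succ]; ring

/-- Multiplication by `2 + w + w⁻¹` on coefficient sequences of Laurent series in `w`. -/
def walkOp : Module.End ℚ (ℤ → ℚ) where
  toFun h m := h (m + 1) + 2 * h m + h (m - 1)
  map_add' _ _ := by ext; simp; ring
  map_smul' _ _ := by ext; simp; ring

/-- For `c` odd about `-1` this is the linear functional sending `shiftedS i` to `c i`,
see `walkForm_shiftedS`. -/
noncomputable def walkForm (c : ℤ → ℚ) : ℚ[X] →ₗ[ℚ] ℚ :=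
  LinearMap.proj 0 ∘ₗ LinearMap.applyₗ c ∘ₗ (aeval walkOp).toLinearMap

lemma walkForm_apply (c : ℤ → ℚ) (p : ℚ[X]) : walkForm c p = aeval walkOp p c 0 := rfl

lemma walkForm_mul (c : ℤ → ℚ) (p q : ℚ[X]) :
    walkForm c (p * q) = walkForm (aeval walkOp q c) p := by
  simp [walkForm_apply]

lemma aeval_walkOp_X_sub_two (c : ℤ → ℚ) (m : ℤ) :
    aeval walkOp (X - 2 : ℚ[X]) c m = c (m + 1) + c (m - 1) := by
  have h : aeval walkOp (2 : ℚ[X]) = (2 : Module.End ℚ (ℤ → ℚ)) := map_ofNat _ 2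
  rw [map_sub, aeval_X, h]
  change c (m + 1) + 2 * c m + c (m - 1) - ((2 : Module.End ℚ (ℤ → ℚ)) c) m = _
  rw [Module.End.ofNat_apply]
  simp; ring

lemma walkForm_shiftedS {c : ℤ → ℚ} (hc : ∀ m, c (-2 - m) = -c m) (i : ℕ) :
    walkForm c (shiftedS i) = c i := by
  have hz : ∀ {c : ℤ → ℚ}, (∀ m, c (-2 - m) = -c m) → c (-1) = 0 := fun {c} h => by
    have := h (-1); norm_num at this; linarith
  induction i using Nat.twoStepInduction generalizing c with
  | zero => simp [shiftedS, walkForm_apply]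
  | one =>
    simp only [shiftedS, walkForm_apply, aeval_walkOp_X_sub_two]
    simp [hz hc]
  | more n ih ih' =>
    rw [shiftedS, map_sub, mul_comm, walkForm_mul, ih hc, ih', aeval_walkOp_X_sub_two]
    · push_cast; ring_nf
    · intro m
      simp only [aeval_walkOp_X_sub_two]
      rw [show -2 - m + 1 = -2 - (m - 1) by ring, show -2 - m - 1 = -2 - (m + 1) by ring, hc, hc]
      ring

lemma aeval_walkOp_dirichletPoly (c : ℤ → ℚ) (k : ℕ) (m : ℤ) :
    aeval walkOp (dirichletPoly k) c m = ∑ j ∈ Finset.range (2 * k + 1), c (m - k + j) := by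
  induction k using Nat.twoStepInduction generalizing m with
  | zero => simp [dirichletPoly]
  | one =>
    rw [dirichletPoly, show (X - 1 : ℚ[X]) = X - 2 + 1 by ring, map_add, LinearMap.add_apply,
      Pi.add_apply, aeval_walkOp_X_sub_two]
    simp [Finset.sum_range_succ]; ring_nf
  | more n ih ih' =>
    rw [dirichletPoly, map_sub, LinearMap.sub_apply, Pi.sub_apply, ih, map_mul,
      Module.End.mul_apply, aeval_walkOp_X_sub_two, ih', ih']
    have e1 : m + 1 - (n + 1 : ℕ) = m - n := by push_cast; ring
    have e2 : m - 1 - (n + 1 : ℕ) = m - (n + 2 : ℕ) := by push_cast; ring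
    rw [e1, e2, show 2 * (n + 2) + 1 = 2 * (n + 1) + 1 + 1 + 1 by ring,
      Finset.sum_range_succ _ (2 * (n + 1) + 1 + 1),
      Finset.sum_range_succ _ (2 * (n + 1) + 1), show 2 * (n + 1) + 1 = 2 * n + 1 + 1 + 1 by ring,
      Finset.sum_range_succ _ (2 * n + 1 + 1), Finset.sum_range_succ _ (2 * n + 1)]
    have e3 : m - (n : ℤ) + (2 * n + 1 : ℕ) = m - (n + 2 : ℕ) + (2 * n + 1 + 1 + 1 : ℕ) := by
      push_cast; ring
    have e4 : m - (n : ℤ) + (2 * n + 1 + 1 : ℕ) = m - (n + 2 : ℕ) + (2 * n + 1 + 1 + 1 + 1 : ℕ) := by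
      push_cast; ring
    rw [e3, e4]; ring

/-- The coefficient sequence of `shiftedS 0`, odd about `-1`. -/
def deltaSeq (m : ℤ) : ℚ := if m = 0 then 1 else if m = -2 then -1 else 0

lemma deltaSeq_odd (m : ℤ) : deltaSeq (-2 - m) = -deltaSeq m := by
  unfold deltaSeq; split_ifs <;> first | omega | simp

lemma aeval_X_pow_deltaSeq (j : ℕ) :
    (∀ m, aeval walkOp (X ^ j : ℚ[X]) deltaSeq (-2 - m) = -aeval walkOp (X ^ j : ℚ[X]) deltaSeq m) ∧
    (∀ i : ℤ, j < i → aeval walkOp (X ^ j : ℚ[X]) deltaSeq i = 0) ∧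
    aeval walkOp (X ^ j : ℚ[X]) deltaSeq j = 1 := by
  induction j with
  | zero =>
    refine ⟨by simpa using deltaSeq_odd, fun i hi => ?_, by simp [deltaSeq]⟩
    simp only [Nat.cast_zero] at hi
    simp [deltaSeq, hi.ne']; omega
  | succ j ih =>
    have hs : ∀ m, aeval walkOp (X ^ (j + 1) : ℚ[X]) deltaSeq m =
        aeval walkOp (X ^ j : ℚ[X]) deltaSeq (m + 1) + 2 * aeval walkOp (X ^ j : ℚ[X]) deltaSeq m
        + aeval walkOp (X ^ j : ℚ[X]) deltaSeq (m - 1) := fun m => by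
      rw [pow_succ', map_mul, aeval_X]; rfl
    obtain ⟨h1, h2, h3⟩ := ih
    refine ⟨fun m => ?_, fun i hi => ?_, ?_⟩
    · rw [hs, hs, show -2 - m + 1 = -2 - (m - 1) by ring,
        show -2 - m - 1 = -2 - (m + 1) by ring, h1, h1, h1]; ring
    · push_cast at hi
      rw [hs, h2 _ (by omega), h2 _ (by omega), h2 _ (by omega)]; simp
    · rw [hs, h2 _ (by push_cast; omega), h2 _ (by push_cast; omega)]
      simpa using h3

lemma dirichletPoly_mul_X (k : ℕ) : X * dirichletPoly (k + 1) =
    dirichletPoly (k + 2) + 2 * dirichletPoly (k + 1) + dirichletPoly k := by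
  rw [dirichletPoly]; ring

lemma walkForm_deltaSeq_moment (N k : ℕ) : walkForm deltaSeq (X ^ N * dirichletPoly k) =
    ((2 * N + 2).choose (N + 1 + k) : ℚ) - (2 * N + 2).choose (N + 2 + k) := by
  induction N generalizing k with
  | zero =>
    rw [pow_zero, one_mul, walkForm_apply, aeval_walkOp_dirichletPoly]
    match k with
    | 0 => norm_num [deltaSeq]
    | 1 => simp [deltaSeq, Finset.sum_range_succ]
    | k + 2 =>
      rw [Nat.choose_eq_zero_of_lt (by lia), Nat.choose_eq_zero_of_lt (by lia)]
      have h0 : k + 2 ∈ Finset.range (2 * (k + 2) + 1) := by simp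
      have h2 : k ∈ (Finset.range (2 * (k + 2) + 1)).erase (k + 2) := by simp; lia
      rw [← Finset.add_sum_erase _ _ h0, ← Finset.add_sum_erase _ _ h2, Finset.sum_eq_zero]
      · simp [deltaSeq]
      · intro x hx
        simp only [Finset.mem_erase, Finset.mem_range] at hx
        unfold deltaSeq
        push_cast
        rw [if_neg (by omega), if_neg (by omega)]
  | succ N ih =>
    have hp : ∀ a b : ℕ, (a + 2).choose (b + 2) = a.choose b + 2 * a.choose (b + 1) +
        a.choose (b + 2) := fun a b => by
      rw [Nat.choose_succ_succ', Nat.choose_succ_succ', Nat.choose_succ_succ' a (b + 1)]; ring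
    rw [show 2 * (N + 1) + 2 = 2 * N + 2 + 2 by ring]
    match k with
    | 0 =>
      have : X ^ (N + 1) * dirichletPoly 0 = X ^ N * dirichletPoly 1 + X ^ N * dirichletPoly 0 := by
        simp only [dirichletPoly]; ring
      rw [this, map_add, ih, ih]
      have hs : (2 * N + 2).choose N = (2 * N + 2).choose (N + 2) :=
        Nat.choose_symm_of_eq_add (by ring)
      rw [show N + 1 + 1 + 0 = N + 2 by ring, show N + 1 + 2 + 0 = N + 1 + 2 by ring,
        hp (2 * N + 2) N, hp (2 * N + 2) (N + 1), hs]
      push_cast; ring_nf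
    | k + 1 =>
      have : X ^ (N + 1) * dirichletPoly (k + 1) = X ^ N * dirichletPoly (k + 2) +
          ((2 : ℚ) • (X ^ N * dirichletPoly (k + 1)) + X ^ N * dirichletPoly k) := by
        rw [pow_succ, mul_assoc, dirichletPoly_mul_X, smul_eq_C_mul]
        simp only [map_ofNat]; ring
      rw [this, map_add, map_add, map_smul, ih, ih, ih, smul_eq_mul,
        show N + 1 + 1 + (k + 1) = N + 1 + k + 2 by ring,
        show N + 1 + 2 + (k + 1) = N + 2 + k + 2 by ring,
        hp (2 * N + 2) (N + 1 + k), hp (2 * N + 2) (N + 2 + k)]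
      push_cast; ring_nf

lemma walkForm_deltaSeq_entry (i j k : ℕ) :
    walkForm deltaSeq (X ^ i * (X * dirichletPoly k) * X ^ j) =
      ((2 * k + 1 : ℚ) / ((i + j + k + 3 : ℕ) : ℚ)) *
        ((2 * i + 2 * j + 4).choose (i + j + k + 2) : ℚ) := by
  rw [show X ^ i * (X * dirichletPoly k) * X ^ j = X ^ (i + j + 1) * dirichletPoly k by ring,
    walkForm_deltaSeq_moment, show 2 * (i + j + 1) + 2 = 2 * i + 2 * j + 4 by ring,
    show i + j + 1 + 1 + k = i + j + k + 2 by ring,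
    show i + j + 1 + 2 + k = i + j + k + 2 + 1 by ring]
  have h3 : ((i + j + k + 3 : ℕ) : ℚ) ≠ 0 := by positivity
  have h : ((2 * i + 2 * j + 4).choose (i + j + k + 2 + 1) : ℚ) * ((i + j + k + 3 : ℕ) : ℚ) =
      (2 * i + 2 * j + 4).choose (i + j + k + 2) * ((i : ℚ) + j + 2 - k) := by
    have hn := Nat.choose_succ_right_eq (2 * i + 2 * j + 4) (i + j + k + 2)
    rcases le_or_gt k (i + j + 2) with hk | hk
    · have : ((2 * i + 2 * j + 4 - (i + j + k + 2) : ℕ) : ℚ) = (i : ℚ) + j + 2 - k := by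
        rw [Nat.cast_sub (by lia)]; push_cast; ring
      rw [← this]; exact_mod_cast hn
    · rw [Nat.choose_eq_zero_of_lt (by lia), Nat.choose_eq_zero_of_lt (by lia)]; simp
  field_simp
  rw [sub_mul, h]; push_cast; ring

/-- The `(2k+1)`-periodic sequence, odd about `-1`, with value `1` at `b`, and `0` at
`0 ≤ m < k`, `m ≠ b`. -/
def periodicSeq (k b : ℕ) (m : ℤ) : ℚ :=
  (if (2 * k + 1 : ℤ) ∣ m - b then 1 else 0) - if (2 * k + 1 : ℤ) ∣ m + 2 + b then 1 else 0

lemma periodicSeq_odd (k b : ℕ) (m : ℤ) : periodicSeq k b (-2 - m) = -periodicSeq k b m := by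
  unfold periodicSeq
  simp only [show -2 - m - (b : ℤ) = -(m + 2 + b) by ring,
    show -2 - m + 2 + (b : ℤ) = -(m - b) by ring, dvd_neg]
  ring

lemma periodicSeq_periodic (k b : ℕ) : Function.Periodic (periodicSeq k b) (2 * k + 1 : ℤ) := by
  intro m
  unfold periodicSeq
  simp only [show m + (2 * k + 1) - (b : ℤ) = m - b + (2 * k + 1) by ring,
    show m + (2 * k + 1) + 2 + (b : ℤ) = m + 2 + b + (2 * k + 1) by ring, dvd_add_self_right]

lemma periodicSeq_of_mem {k b : ℕ} (hb : b < k) {s : ℤ} (hs : -1 ≤ s) (hs' : s ≤ 2 * k) :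
    periodicSeq k b s = (if s = b then 1 else 0) - if s + 1 + b = 2 * k then 1 else 0 := by
  unfold periodicSeq
  congr 2
  · rw [eq_iff_iff]
    refine ⟨fun ⟨z, hz⟩ => ?_, fun h => by simp [h]⟩
    have h1 : z < 1 := by by_contra!; nlinarith
    have h2 : -1 < z := by by_contra!; nlinarith
    have : z = 0 := by omega
    subst this; omega
  · rw [eq_iff_iff]
    refine ⟨fun ⟨z, hz⟩ => ?_, fun h => ⟨1, by omega⟩⟩
    have h1 : z < 2 := by by_contra!; nlinarith
    have h2 : 0 < z := by by_contra!; nlinarith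
    have : z = 1 := by omega
    subst this; omega

lemma periodicSeq_mul_add {k b : ℕ} (hb : b < k) (z : ℤ) {s : ℤ} (hs : -1 ≤ s)
    (hs' : s ≤ 2 * k) : periodicSeq k b (z * (2 * k + 1) + s) =
      (if s = b then 1 else 0) - if s + 1 + b = 2 * k then 1 else 0 := by
  rw [add_comm, show periodicSeq k b (s + z * (2 * k + 1)) = periodicSeq k b s from
    (periodicSeq_periodic k b).int_mul z s, periodicSeq_of_mem hb hs hs']

/-- A periodic sequence odd about `-1` sums to zero over every period. -/
lemma sum_period_eq_zero {c : ℤ → ℚ} {q : ℕ} (hp : Function.Periodic c (q : ℤ))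
    (hc : ∀ m, c (-2 - m) = -c m) (m : ℤ) : ∑ j ∈ Finset.range q, c (m + j) = 0 := by
  set G : ℤ → ℚ := fun m => ∑ j ∈ Finset.range q, c (m + j) with hG
  have hG1 : Function.Periodic G 1 := fun m => by
    have h := Finset.sum_range_succ (fun j : ℕ => c (m + j)) q
    rw [Finset.sum_range_succ', hp m] at h
    simp only [Nat.cast_zero, add_zero, add_left_inj] at h
    simp only [hG, ← h]
    exact Finset.sum_congr rfl fun j _ => by push_cast; ring_nf
  have hconst : ∀ m, G m = G 0 := fun m => by simpa using hG1.int_mul m 0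
  have hrefl : G (-1 - q - m) = -G m := by
    simp only [hG]
    rw [← Finset.sum_range_reflect, ← Finset.sum_neg_distrib]
    refine Finset.sum_congr rfl fun j hj => ?_
    rw [← hc, Nat.cast_sub (by simp at hj; lia), Nat.cast_sub (by simp at hj; lia)]
    push_cast; ring_nf
  rw [hconst, hconst m] at hrefl
  change G m = 0
  rw [hconst]; linarith

lemma walkForm_mul_dirichletPoly (k b : ℕ) (p : ℚ[X]) :
    walkForm (periodicSeq k b) (p * dirichletPoly k) = 0 := by
  have : aeval walkOp (dirichletPoly k) (periodicSeq k b) = 0 := by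
    ext m
    rw [aeval_walkOp_dirichletPoly]
    exact sum_period_eq_zero (by simpa using periodicSeq_periodic k b) (periodicSeq_odd k b) _
  rw [walkForm_mul, this]
  simp [walkForm_apply]

/-- Replacing the monomials by monic polynomials does not change a determinant of values of linear
functionals. -/
lemma det_functional_monic {R : Type*} [CommRing R] {N : ℕ} (θ : Fin N → R[X] →ₗ[R] R)
    {p : ℕ → R[X]} (hp : ∀ i < N, (p i).Monic ∧ (p i).natDegree = i) :
    (Matrix.of fun i j : Fin N => θ j (p i)).det =
      (Matrix.of fun i j : Fin N => θ j (X ^ (i : ℕ))).det := by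
  have h : (Matrix.of fun i j : Fin N => θ j (p i)) =
      (Matrix.of fun i j : Fin N => (p j).coeff i).transpose *
        (Matrix.of fun i j : Fin N => θ j (X ^ (i : ℕ))) := by
    ext i j
    simp only [Matrix.of_apply, Matrix.mul_apply, Matrix.transpose_apply]
    conv_lhs => rw [(p i).as_sum_range' N (by rw [(hp i i.2).2]; exact i.2)]
    rw [map_sum, ← Fin.sum_univ_eq_sum_range (fun l => θ j (monomial l ((p i).coeff l)))]
    refine Finset.sum_congr rfl fun l _ => ?_
    rw [← smul_X_eq_monomial, map_smul, smul_eq_mul]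
  rw [h, Matrix.det_mul, Matrix.det_transpose,
    Matrix.det_matrixOfPolynomials (fun i : Fin N => p i) (fun i => (hp i i.2).2)
      (fun i => (hp i i.2).1), one_mul]

lemma sign_finCycle {N : ℕ} (i : Fin N) :
    Equiv.Perm.sign (finCycle i) = (-1) ^ ((N - 1) * i) := by
  have : finCycle i = finRotate N ^ (i : ℕ) := by
    apply Equiv.ext; intro x
    rw [finCycle_eq_finRotate_iterate, Equiv.Perm.iterate_eq_pow]
  rw [this, map_pow, sign_finRotate, pow_mul]

/-- The linear functionals `q ↦ L (q * X ^ j)` with `L = walkForm deltaSeq`, preceded by `k + 1`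
functionals annihilating the multiples of `X * dirichletPoly k`. -/
noncomputable def testFunctional (k m : ℕ) : ℚ[X] →ₗ[ℚ] ℚ :=
  if m < k then walkForm (periodicSeq k m)
  else if m = k then leval 0
  else walkForm deltaSeq ∘ₗ LinearMap.mulRight ℚ (X ^ (m - (k + 1)))

lemma testFunctional_shiftedS_of_lt (k b : ℕ) (hb : b < k + 1) (m : ℕ) :
    testFunctional k b (shiftedS m) =
      if b < k then periodicSeq k b m else (-1) ^ m * ((m : ℚ) + 1) := by
  unfold testFunctional
  split_ifs with h1 h2
  · exact walkForm_shiftedS (periodicSeq_odd k b) m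
  · exact shiftedS_eval_zero m
  · lia

lemma testFunctional_mul (k b : ℕ) (hb : b < k + 1) (p : ℚ[X]) :
    testFunctional k b (p * (X * dirichletPoly k)) = 0 := by
  unfold testFunctional
  split_ifs with h1 h2
  · rw [← mul_assoc]; exact walkForm_mul_dirichletPoly k b _
  · simp
  · lia

lemma testFunctional_add (k j : ℕ) (p : ℚ[X]) :
    testFunctional k (k + 1 + j) p = walkForm deltaSeq (p * X ^ j) := by
  unfold testFunctional
  rw [if_neg (by lia), if_neg (by lia), Nat.add_sub_cancel_left]; rfl

/-- The matrix of the values at `shiftedS (n + a)`, `a ≤ k`, of the functionals annihilating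
the multiples of `X * dirichletPoly k`. -/
noncomputable def windowMatrix (n k : ℕ) : Matrix (Fin (k + 1)) (Fin (k + 1)) ℚ :=
  Matrix.of fun a b => if b.1 < k then periodicSeq k b (n + a : ℕ)
    else (-1) ^ (n + a.1) * ((n + a.1 : ℕ) + 1 : ℚ)

/-- The polynomials `shiftedS m` (`m < k`), `dirichletPoly k` and then the multiples of
`X * dirichletPoly k` by powers of `X`. -/
noncomputable def divisionBasis (k m : ℕ) : ℚ[X] :=
  if m < k then shiftedS m
  else if m = k then dirichletPoly k
  else X ^ (m - (k + 1)) * (X * dirichletPoly k)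

lemma divisionBasis_monic_natDegree (k m : ℕ) :
    (divisionBasis k m).Monic ∧ (divisionBasis k m).natDegree = m := by
  unfold divisionBasis
  split_ifs with h1 h2
  · exact shiftedS_monic_natDegree m
  · rw [h2]; exact dirichletPoly_monic_natDegree k
  · obtain ⟨hm, hd⟩ := dirichletPoly_monic_natDegree k
    refine ⟨(monic_X_pow _).mul (monic_X.mul hm), ?_⟩
    rw [(monic_X_pow _).natDegree_mul (monic_X.mul hm), monic_X.natDegree_mul hm, hd]
    simp; lia

/-- The Hankel matrix of moments of the functional `p ↦ L (X * dirichletPoly k * p)`. -/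
noncomputable def ballotHankel (n k : ℕ) : Matrix (Fin n) (Fin n) ℚ :=
  Matrix.of fun i j : Fin n => ((2 * k + 1 : ℚ) / ((i.1 + j.1 + k + 3 : ℕ) : ℚ)) *
    ((2 * i.1 + 2 * j.1 + 4).choose (i.1 + j.1 + k + 2) : ℚ)

lemma det_testFunctional_divisionBasis (n k : ℕ) :
    (Matrix.of fun i j : Fin (k + 1 + n) => testFunctional k j (divisionBasis k i)).det =
      (-1) ^ k * (ballotHankel n k).det := by
  set A := Matrix.of fun i j : Fin (k + 1 + n) => testFunctional k j (divisionBasis k i)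
  have hb : A.submatrix finSumFinEquiv finSumFinEquiv = Matrix.fromBlocks
      (Matrix.of fun a b : Fin (k + 1) => testFunctional k b (divisionBasis k a))
      (Matrix.of fun (a : Fin (k + 1)) (j : Fin n) =>
        testFunctional k (k + 1 + j) (divisionBasis k a)) 0 (ballotHankel n k) := by
    ext i j
    rcases i with a | i <;> rcases j with b | j <;>
      simp only [A, Matrix.submatrix_apply, Matrix.of_apply, finSumFinEquiv_apply_left,
        finSumFinEquiv_apply_right, Matrix.fromBlocks_apply₁₁, Matrix.fromBlocks_apply₁₂,
        Matrix.fromBlocks_apply₂₁, Matrix.fromBlocks_apply₂₂, Fin.val_castAdd, Fin.val_natAdd]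
    · rw [divisionBasis, if_neg (by lia), if_neg (by lia), testFunctional_mul k b b.2]; rfl
    · rw [divisionBasis, if_neg (by lia), if_neg (by lia), testFunctional_add,
        Nat.add_sub_cancel_left, walkForm_deltaSeq_entry]; rfl
  rw [← Matrix.det_submatrix_equiv_self finSumFinEquiv, hb, Matrix.det_fromBlocks_zero₂₁]
  congr 1
  have hd : ∀ b : ℕ, b < k → testFunctional k b (dirichletPoly k) = 0 := fun b hb => by
    rw [testFunctional, if_pos hb, ← one_mul (dirichletPoly k), walkForm_mul_dirichletPoly]
  have hs : ∀ a b : ℕ, a < k → b < k → testFunctional k b (shiftedS a) = if a = b then 1 else 0 := by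
    intro a b ha hb
    rw [testFunctional_shiftedS_of_lt k b (by lia), if_pos hb, periodicSeq_of_mem hb (by lia) (by lia),
      if_neg (by omega : ¬ (a : ℤ) + 1 + b = 2 * k)]
    simp
  rw [Matrix.det_of_isUpperTriangular, Fin.prod_univ_castSucc]
  · rw [Finset.prod_eq_one]
    · simp [divisionBasis, testFunctional, dirichletPoly_eval_zero]
    · intro a _
      simp only [Matrix.of_apply, Fin.val_castSucc]
      rw [divisionBasis, if_pos a.2, hs _ _ a.2 a.2, if_pos rfl]
  · intro a b hab
    simp only [id, Fin.lt_def] at hab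
    simp only [Matrix.of_apply]
    unfold divisionBasis
    split_ifs with h1 h2
    · rw [hs _ _ h1 (by lia), if_neg (by lia)]
    · exact hd _ (by lia)
    · lia

lemma det_testFunctional_shiftedS (n k : ℕ) :
    (windowMatrix n k).det = (-1) ^ ((k + n) * n) *
      (Matrix.of fun i j : Fin (k + 1 + n) => testFunctional k j (shiftedS i)).det := by
  set P := Matrix.of fun i j : Fin (k + 1 + n) => testFunctional k j (shiftedS i)
  set s : Fin (k + 1 + n) := ⟨n, by lia⟩
  have hb : (P.submatrix (finCycle s) id).submatrix finSumFinEquiv finSumFinEquiv =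
      Matrix.fromBlocks (windowMatrix n k) (Matrix.of fun (a : Fin (k + 1)) (j : Fin n) => (0 : ℚ))
        (Matrix.of fun (i : Fin n) (b : Fin (k + 1)) => testFunctional k b (shiftedS i))
        (Matrix.of fun i j : Fin n => walkForm deltaSeq (shiftedS i * X ^ (j : ℕ))) := by
    have hl : ∀ a : Fin (k + 1), ((finCycle s (Fin.castAdd n a) : Fin _) : ℕ) = n + a := fun a => by
      rw [finCycle_apply, Fin.val_add, Fin.val_castAdd, Nat.mod_eq_of_lt (by simp [s]; lia)]
      simp [s, add_comm]
    have hr : ∀ i : Fin n, ((finCycle s (Fin.natAdd (k + 1) i) : Fin _) : ℕ) = i := fun i => by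
      rw [finCycle_apply, Fin.val_add, Fin.val_natAdd,
        show k + 1 + (i : ℕ) + (s : ℕ) = i + (k + 1 + n) by simp [s]; ring,
        Nat.add_mod_right, Nat.mod_eq_of_lt (by lia)]
    ext i j
    rcases i with a | i <;> rcases j with b | j <;>
      simp only [P, Matrix.submatrix_apply, Matrix.of_apply, finSumFinEquiv_apply_left,
        finSumFinEquiv_apply_right, Matrix.fromBlocks_apply₁₁, Matrix.fromBlocks_apply₁₂,
        Matrix.fromBlocks_apply₂₁, Matrix.fromBlocks_apply₂₂, Fin.val_castAdd, Fin.val_natAdd,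
        id, hl, hr, testFunctional_add]
    · rw [testFunctional_shiftedS_of_lt k b b.2]; rfl
    · rw [walkForm_mul, walkForm_shiftedS (aeval_X_pow_deltaSeq j).1,
        (aeval_X_pow_deltaSeq j).2.1 _ (by have := j.2; push_cast; omega)]
  have ht : (Matrix.of fun i j : Fin n => walkForm deltaSeq (shiftedS i * X ^ (j : ℕ))).det = 1 := by
    rw [Matrix.det_of_isUpperTriangular, Finset.prod_eq_one]
    · intro i _
      rw [Matrix.of_apply, walkForm_mul, walkForm_shiftedS (aeval_X_pow_deltaSeq i).1,
        (aeval_X_pow_deltaSeq i).2.2]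
    · intro i j hij
      simp only [id, Fin.lt_def] at hij
      rw [Matrix.of_apply, walkForm_mul, walkForm_shiftedS (aeval_X_pow_deltaSeq j).1,
        (aeval_X_pow_deltaSeq j).2.1 _ (by lia)]
  have hdet := congrArg Matrix.det hb
  rw [Matrix.det_submatrix_equiv_self, Matrix.det_permute, sign_finCycle,
    show (Matrix.of fun (a : Fin (k + 1)) (j : Fin n) => (0 : ℚ)) = 0 from rfl,
    Matrix.det_fromBlocks_zero₁₂, ht, mul_one] at hdet
  rw [← hdet, show k + 1 + n - 1 = k + n by lia]
  simp [s]

/-- Christoffel's formula for the Hankel determinant of `X * dirichletPoly k`. -/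
lemma det_ballotHankel (n k : ℕ) :
    (ballotHankel n k).det = (-1) ^ (k + (k + 1) * n) * (windowMatrix n k).det := by
  rw [det_testFunctional_shiftedS, det_functional_monic _ fun i _ => shiftedS_monic_natDegree i,
    ← det_functional_monic _ fun i _ => divisionBasis_monic_natDegree k i,
    det_testFunctional_divisionBasis, ← mul_assoc, ← mul_assoc, ← pow_add, ← pow_add,
    Even.neg_one_pow, one_mul]
  have := Nat.even_mul_succ_self n
  rw [show k + (k + 1) * n + (k + n) * n + k = 2 * (k + k * n) + n * (n + 1) by ring]
  exact (even_two_mul _).add this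

lemma det_antidiagonal (k : ℕ) :
    (Matrix.of fun a b : Fin k => if a.1 + b.1 + 1 = k then (1 : ℚ) else 0).det =
      (-1) ^ k.choose 2 := by
  induction k with
  | zero => simp
  | succ k ih =>
    rw [Matrix.det_succ_column_zero, Fin.sum_univ_castSucc, Finset.sum_eq_zero, zero_add,
      Fin.succAbove_last]
    · rw [Nat.choose_succ_succ' k 1, Nat.choose_one_right, pow_add, ← ih]
      simp only [Matrix.of_apply, Fin.val_last, Fin.val_zero, add_zero, if_true, mul_one]
      congr 2
      ext a b
      simp [← add_assoc]
    · intro a _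
      simp [a.2.ne]

lemma det_eq_of_row_castSucc_eq_zero {k : ℕ} (A : Matrix (Fin (k + 1)) (Fin (k + 1)) ℚ)
    (i : Fin (k + 1)) (h : ∀ b : Fin k, A i b.castSucc = 0) :
    A.det = (-1) ^ (i + k : ℕ) * A i (Fin.last k) * (A.submatrix i.succAbove Fin.castSucc).det := by
  rw [Matrix.det_succ_row A i, Fin.sum_univ_castSucc, Finset.sum_eq_zero, zero_add,
    Fin.succAbove_last, Fin.val_last]
  intro b _
  simp [h]

lemma windowMatrix_castSucc {n k : ℕ} {z r : ℤ} (hn : (n : ℤ) = z * (2 * k + 1) + r)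
    (a : Fin (k + 1)) (b : Fin k) (h : -1 ≤ r + a) (h' : r + a ≤ 2 * k) :
    windowMatrix n k a b.castSucc =
      (if r + a = b then 1 else 0) - if r + a + 1 + b = 2 * k then 1 else 0 := by
  rw [windowMatrix, Matrix.of_apply, if_pos (by simp), Nat.cast_add, hn, add_assoc,
    Fin.val_castSucc, periodicSeq_mul_add b.2 z h h']

lemma windowMatrix_last (n k : ℕ) (a : Fin (k + 1)) :
    windowMatrix n k a (Fin.last k) = (-1) ^ (n + a.1) * ((n + a.1 : ℕ) + 1 : ℚ) := by
  simp [windowMatrix]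

lemma neg_one_pow_eq_of_even_add {a b : ℕ} (h : Even (a + b)) : (-1 : ℚ) ^ a = (-1) ^ b := by
  rcases Nat.even_or_odd b with hb | hb
  · rw [hb.neg_one_pow, ((Nat.even_add.1 h).2 hb).neg_one_pow]
  · rw [hb.neg_one_pow, (Nat.not_even_iff_odd.1 (mt (Nat.even_add.1 h).1
      (Nat.not_even_iff_odd.2 hb))).neg_one_pow]

lemma det_ballotHankel_of_add_one_eq {n k n₁ : ℕ} (h : n + 1 = n₁ * (2 * k + 1)) :
    (ballotHankel n k).det = (-1) ^ (k * (n₁ + 1)) * ((n + 1 : ℕ) : ℚ) := by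
  have hn : (n : ℤ) = n₁ * (2 * k + 1) + -1 := by
    have : ((n + 1 : ℕ) : ℤ) = (n₁ * (2 * k + 1) : ℕ) := by rw [h]
    push_cast at this; linarith
  rw [det_ballotHankel, det_eq_of_row_castSucc_eq_zero _ 0, windowMatrix_last]
  · have : (windowMatrix n k).submatrix (Fin.succAbove 0) Fin.castSucc = 1 := by
      ext a b
      have ha := a.2
      have hb := b.2
      rw [Matrix.submatrix_apply, Fin.succAbove_zero,
        windowMatrix_castSucc hn _ _ (by simp) (by simp; omega), Matrix.one_apply]
      simp only [Fin.val_succ, Fin.ext_iff]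
      push_cast
      rw [if_neg (by omega : ¬ (-1 + ((a : ℤ) + 1) + 1 + b = 2 * k))]
      simp
    rw [this, Matrix.det_one, mul_one, Fin.val_zero, add_zero, zero_add, ← mul_assoc, ← mul_assoc,
      ← pow_add, ← pow_add]
    rw [neg_one_pow_eq_of_even_add (b := k * (n₁ + 1))]
    · push_cast; ring
    · have h2 := congrArg Even h
      simp only [Nat.even_add, Nat.even_mul, even_two, Nat.not_even_one, eq_iff_iff] at h2 ⊢
      tauto
  · intro b
    have hb := b.2
    rw [windowMatrix_castSucc hn _ _ (by simp) (by simp; omega), Fin.val_zero]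
    rw [if_neg (by omega), if_neg (by omega), sub_zero]

lemma det_ballotHankel_of_eq {n k n₁ : ℕ} (hk : 0 < k) (h : n = n₁ * (2 * k + 1)) :
    (ballotHankel n k).det = (-1) ^ (k * n₁) := by
  have hn : (n : ℤ) = n₁ * (2 * k + 1) + 0 := by rw [h]; push_cast; ring
  set i : Fin (k + 1) := ⟨k - 1, by lia⟩ with hi
  have hil : Fin.last k ≠ i := by simp [Fin.ext_iff, i]; lia
  rw [det_ballotHankel, ← Matrix.det_updateRow_add_self _ hil,
    det_eq_of_row_castSucc_eq_zero _ (Fin.last k)]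
  · have : ((windowMatrix n k).updateRow (Fin.last k) (windowMatrix n k (Fin.last k) +
        windowMatrix n k i)).submatrix (Fin.succAbove (Fin.last k)) Fin.castSucc = 1 := by
      ext a b
      have ha := a.2
      have hb := b.2
      rw [Matrix.submatrix_apply, Fin.succAbove_last, Matrix.updateRow_ne (Fin.castSucc_ne_last a),
        windowMatrix_castSucc hn _ _ (by simp) (by simp; omega), Matrix.one_apply]
      simp only [Fin.val_castSucc, Fin.ext_iff]
      rw [if_neg (by omega : ¬ (0 + (a : ℤ) + 1 + b = 2 * k))]
      simp
    have hs : (-1 : ℚ) ^ (n + k) = -(-1) ^ (n + (k - 1)) := by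
      rw [show n + k = n + (k - 1) + 1 by lia, pow_succ]; ring
    rw [this, Matrix.det_one, mul_one, Matrix.updateRow_self, Pi.add_apply, windowMatrix_last,
      windowMatrix_last, Fin.val_last, hs, hi]
    have hc : ((n + (k - 1) : ℕ) : ℚ) = ((n + k : ℕ) : ℚ) - 1 := by
      rw [show n + k = n + (k - 1) + 1 by lia]; push_cast; ring
    simp only [hc]
    rw [show -(-1 : ℚ) ^ (n + (k - 1)) * (((n + k : ℕ) : ℚ) + 1) +
      (-1) ^ (n + (k - 1)) * (((n + k : ℕ) : ℚ) - 1 + 1) = (-1) ^ (n + k) by rw [hs]; ring,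
      ← pow_add, ← pow_add]
    apply neg_one_pow_eq_of_even_add
    have h2 := congrArg Even h
    simp only [Nat.even_add, Nat.even_mul, even_two, Nat.not_even_one, eq_iff_iff] at h2 ⊢
    tauto
  · intro b
    have hb := b.2
    rw [Matrix.updateRow_self, Pi.add_apply,
      windowMatrix_castSucc hn _ _ (by simp) (by simp; omega),
      windowMatrix_castSucc hn _ _ (by omega) (by simp [hi]; omega), Fin.val_last, hi]
    simp only
    split_ifs <;> first | omega | simp

lemma det_antidiagonal_neg {k : ℕ} {A : Matrix (Fin k) (Fin k) ℚ}
    (h : ∀ a b, A a b = if a.1 + b.1 + 1 = k then -1 else 0) :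
    A.det = (-1) ^ (k + k.choose 2) := by
  have : A = -(Matrix.of fun a b : Fin k => if a.1 + b.1 + 1 = k then (1 : ℚ) else 0) := by
    ext a b; rw [h]; simp only [Matrix.neg_apply, Matrix.of_apply]; split_ifs <;> simp
  rw [this, Matrix.det_neg, det_antidiagonal, Fintype.card_fin, pow_add]

lemma det_ballotHankel_of_add_add_one_eq {n k n₁ : ℕ} (h : n + k + 1 = n₁ * (2 * k + 1)) :
    (ballotHankel n k).det =
      (-1) ^ (k * n₁ + Nat.choose (k + 1) 2) * ((n + k + 1 : ℕ) : ℚ) := by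
  have hn : (n : ℤ) = (n₁ - 1) * (2 * k + 1) + k := by
    have : ((n + k + 1 : ℕ) : ℤ) = (n₁ * (2 * k + 1) : ℕ) := by rw [h]
    push_cast at this; linarith
  rw [det_ballotHankel, det_eq_of_row_castSucc_eq_zero _ (Fin.last k), windowMatrix_last,
    det_antidiagonal_neg, Fin.val_last, mul_right_comm _ _ ((-1 : ℚ) ^ (k + k.choose 2)),
    ← mul_assoc, ← mul_assoc, ← pow_add, ← pow_add, ← pow_add,
    Nat.choose_succ_succ' k 1, Nat.choose_one_right]
  · rw [neg_one_pow_eq_of_even_add (b := k * n₁ + (k + k.choose 2))]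
    · push_cast; ring
    · have h2 := congrArg Even h
      simp only [Nat.even_add, Nat.even_mul, even_two, Nat.not_even_one, eq_iff_iff] at h2 ⊢
      tauto
  · intro a b
    have ha := a.2
    have hb := b.2
    rw [Matrix.submatrix_apply, Fin.succAbove_last,
      windowMatrix_castSucc hn _ _ (by omega) (by simp; omega), Fin.val_castSucc]
    split_ifs <;> first | omega | simp
  · intro b
    have hb := b.2
    rw [windowMatrix_castSucc hn _ _ (by omega) (by simp; omega), Fin.val_last,
      if_neg (by omega), if_neg (by omega), sub_zero]

lemma det_ballotHankel_of_add_add_two_eq {n k n₁ : ℕ} (hk : 0 < k)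
    (h : n + k + 2 = n₁ * (2 * k + 1)) :
    (ballotHankel n k).det = (-1) ^ (k * n₁ + Nat.choose k 2 + 1) := by
  have hn : (n : ℤ) = (n₁ - 1) * (2 * k + 1) + (k - 1) := by
    have : ((n + k + 2 : ℕ) : ℤ) = (n₁ * (2 * k + 1) : ℕ) := by rw [h]
    push_cast at this; linarith
  set i : Fin (k + 1) := ⟨1, by lia⟩ with hi
  have hil : 0 ≠ i := by simp [Fin.ext_iff, i]
  rw [det_ballotHankel, ← Matrix.det_updateRow_add_self _ hil,
    det_eq_of_row_castSucc_eq_zero _ 0, det_antidiagonal_neg]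
  · rw [Matrix.updateRow_self, Pi.add_apply, windowMatrix_last, windowMatrix_last,
      show (-1 : ℚ) ^ (n + (0 : Fin (k + 1)).1) * (((n + (0 : Fin (k + 1)).1 : ℕ) : ℚ) + 1) +
        (-1) ^ (n + i.1) * (((n + i.1 : ℕ) : ℚ) + 1) = (-1) ^ (n + 1) by
        simp [hi, pow_succ]; ring, ← pow_add, ← pow_add, ← pow_add, Fin.val_zero]
    apply neg_one_pow_eq_of_even_add
    have h2 := congrArg Even h
    simp only [Nat.even_add, Nat.even_mul, even_two, Nat.not_even_one, eq_iff_iff] at h2 ⊢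
    revert h2
    generalize Even n = p, Even k = q, Even n₁ = r, Even (k.choose 2) = s
    by_cases p <;> by_cases q <;> by_cases r <;> by_cases s <;> simp_all
  · intro a b
    have ha := a.2
    have hb := b.2
    rw [Matrix.submatrix_apply, Fin.succAbove_zero, Matrix.updateRow_ne (Fin.succ_ne_zero a),
      windowMatrix_castSucc hn _ _ (by omega) (by simp; omega), Fin.val_succ]
    push_cast
    split_ifs <;> first | omega | simp
  · intro b
    have hb := b.2
    rw [Matrix.updateRow_self, Pi.add_apply,
      windowMatrix_castSucc hn _ _ (by omega) (by simp; omega),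
      windowMatrix_castSucc hn _ _ (by omega) (by simp [hi]; omega), Fin.val_zero, hi]
    push_cast
    split_ifs <;> first | omega | simp

lemma det_ballotHankel_eq_zero {n k : ℕ} (h0 : n % (2 * k + 1) ≠ 0)
    (h1 : n % (2 * k + 1) ≠ k - 1) (h2 : n % (2 * k + 1) ≠ k) (h3 : n % (2 * k + 1) ≠ 2 * k) :
    (ballotHankel n k).det = 0 := by
  have hlt := Nat.mod_lt n (show 0 < 2 * k + 1 by lia)
  have hdiv := Nat.mod_add_div n (2 * k + 1)
  set r := n % (2 * k + 1)
  set z := n / (2 * k + 1)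
  have hn : (n : ℤ) = z * (2 * k + 1) + r := by rw [← hdiv]; push_cast; ring
  have hn' : (n : ℤ) = (z + 1) * (2 * k + 1) + (r - (2 * k + 1)) := by rw [hn]; ring
  rw [det_ballotHankel, mul_eq_zero]
  right
  rw [← Matrix.exists_vecMul_eq_zero_iff]
  rcases lt_or_gt_of_ne h2 with hlt' | hgt
  · have hd : k - 2 - r + 3 < k + 1 := by lia
    set d := k - 2 - r
    refine ⟨Pi.single ⟨d, by lia⟩ 1 + (3 : ℚ) • Pi.single ⟨d + 1, by lia⟩ 1 +
      (3 : ℚ) • Pi.single ⟨d + 2, by lia⟩ 1 + Pi.single ⟨d + 3, by lia⟩ 1, fun hv => ?_, ?_⟩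
    · simpa [Pi.single_apply, Fin.ext_iff] using congrFun hv ⟨d, by lia⟩
    · ext b
      simp only [Matrix.add_vecMul, Matrix.smul_vecMul, Matrix.single_one_vecMul, Pi.add_apply,
        Pi.smul_apply, Matrix.row_apply, smul_eq_mul, Pi.zero_apply]
      induction b using Fin.lastCases with
      | last =>
        simp only [windowMatrix_last]; push_cast; ring
      | cast b =>
        have hb := b.2
        rw [windowMatrix_castSucc hn _ _ (by omega) (by simp; omega),
          windowMatrix_castSucc hn _ _ (by omega) (by simp; omega),
          windowMatrix_castSucc hn _ _ (by omega) (by simp; omega),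
          windowMatrix_castSucc hn _ _ (by omega) (by simp; omega)]
        push_cast
        split_ifs <;> first | omega | norm_num
  · have hd : 2 * k - 1 - r + 2 < k + 1 := by lia
    set d := 2 * k - 1 - r
    refine ⟨Pi.single ⟨d, by lia⟩ 1 + (2 : ℚ) • Pi.single ⟨d + 1, by lia⟩ 1 +
      Pi.single ⟨d + 2, by lia⟩ 1, fun hv => ?_, ?_⟩
    · simpa [Pi.single_apply, Fin.ext_iff] using congrFun hv ⟨d, by lia⟩
    · ext b
      simp only [Matrix.add_vecMul, Matrix.smul_vecMul, Matrix.single_one_vecMul, Pi.add_apply,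
        Pi.smul_apply, Matrix.row_apply, smul_eq_mul, Pi.zero_apply]
      induction b using Fin.lastCases with
      | last =>
        simp only [windowMatrix_last]; push_cast; ring
      | cast b =>
        have hb := b.2
        rw [windowMatrix_castSucc hn _ _ (by omega) (by simp; omega),
          windowMatrix_castSucc hn _ _ (by omega) (by simp; omega),
          windowMatrix_castSucc hn' _ _ (by simp; omega) (by simp; omega)]
        push_cast
        split_ifs <;> first | omega | norm_num

end

/-- Corollary 16: evaluations of the `n×n` determinant with `(i,j)`-entry
`(2k+1)/(i+j+k+3)·C(2i+2j+4, i+j+k+2)` over `ℚ` for `k ≥ 2`, together with the case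
`k = 0` (entry `(1/(i+j+3))·C(2i+2j+4, i+j+2)`).  Hypotheses like `n = n₁(2k+1)−k−2`
are stated additively, e.g. `n + k + 2 = n₁(2k+1)`. -/
theorem det_ballot_hankel_two (n : ℕ) (hn : 0 < n) :
    (∀ k : ℕ, 2 ≤ k →
      (∀ n₁ : ℕ, 0 < n₁ → n + k + 2 = n₁ * (2 * k + 1) →
        Matrix.det (Matrix.of fun i j : Fin n =>
            ((2 * k + 1 : ℚ) / ((i.1 + j.1 + k + 3 : ℕ) : ℚ)) *
              ((2 * i.1 + 2 * j.1 + 4).choose (i.1 + j.1 + k + 2) : ℚ)) =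
          (-1 : ℚ) ^ (k * n₁ + Nat.choose k 2 + 1)) ∧
      (∀ n₁ : ℕ, 0 < n₁ → n + k + 1 = n₁ * (2 * k + 1) →
        Matrix.det (Matrix.of fun i j : Fin n =>
            ((2 * k + 1 : ℚ) / ((i.1 + j.1 + k + 3 : ℕ) : ℚ)) *
              ((2 * i.1 + 2 * j.1 + 4).choose (i.1 + j.1 + k + 2) : ℚ)) =
          (-1 : ℚ) ^ (k * n₁ + Nat.choose (k + 1) 2) * ((n + k + 1 : ℕ) : ℚ)) ∧
      (∀ n₁ : ℕ, 0 < n₁ → n + 1 = n₁ * (2 * k + 1) →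
        Matrix.det (Matrix.of fun i j : Fin n =>
            ((2 * k + 1 : ℚ) / ((i.1 + j.1 + k + 3 : ℕ) : ℚ)) *
              ((2 * i.1 + 2 * j.1 + 4).choose (i.1 + j.1 + k + 2) : ℚ)) =
          (-1 : ℚ) ^ (k * (n₁ + 1)) * ((n + 1 : ℕ) : ℚ)) ∧
      (∀ n₁ : ℕ, 0 < n₁ → n = n₁ * (2 * k + 1) →
        Matrix.det (Matrix.of fun i j : Fin n =>
            ((2 * k + 1 : ℚ) / ((i.1 + j.1 + k + 3 : ℕ) : ℚ)) *
              ((2 * i.1 + 2 * j.1 + 4).choose (i.1 + j.1 + k + 2) : ℚ)) =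
          (-1 : ℚ) ^ (k * n₁)) ∧
      (n % (2 * k + 1) ≠ 0 ∧ n % (2 * k + 1) ≠ k - 1 ∧ n % (2 * k + 1) ≠ k ∧
          n % (2 * k + 1) ≠ 2 * k →
        Matrix.det (Matrix.of fun i j : Fin n =>
            ((2 * k + 1 : ℚ) / ((i.1 + j.1 + k + 3 : ℕ) : ℚ)) *
              ((2 * i.1 + 2 * j.1 + 4).choose (i.1 + j.1 + k + 2) : ℚ)) = 0)) ∧
    Matrix.det (Matrix.of fun i j : Fin n =>
        ((1 : ℚ) / ((i.1 + j.1 + 3 : ℕ) : ℚ)) *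
          ((2 * i.1 + 2 * j.1 + 4).choose (i.1 + j.1 + 2) : ℚ)) = ((n + 1 : ℕ) : ℚ) := by
  refine ⟨fun k hk => ⟨fun n₁ _ h => ?_, fun n₁ _ h => ?_, fun n₁ _ h => ?_, fun n₁ _ h => ?_,
    fun ⟨h0, h1, h2, h3⟩ => ?_⟩, ?_⟩
  · exact det_ballotHankel_of_add_add_two_eq (by lia) h
  · exact det_ballotHankel_of_add_add_one_eq h
  · exact det_ballotHankel_of_add_one_eq h
  · exact det_ballotHankel_of_eq (by lia) h
  · exact det_ballotHankel_eq_zero h0 h1 h2 h3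
  · simpa [ballotHankel] using
      det_ballotHankel_of_add_one_eq (n := n) (k := 0) (n₁ := n + 1) (by simp)
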